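/- Suppose X is a Borel subset of a Polish space with its Borel σ-algebra 𝓑, P is a weakly continuous Markov kernel, and A ⊆ X is compact and measurable. Then the largest absorbing subset l.a.s.(A) = {x : u(x;A) = 1} is compact, and the following statements are equivalent: (1) m(A) < ∞; (2) there exist n ≥ 1 and c < 1 such that sup_{x∈X} |(I_A^n f)(x)| ≤ c·sup_{y∈X}|f(y)| for every bounded measurable f : X → ℝ; (3) the only bounded measurable solution of f = I_A f is f ≡ 0; (4) u(x;A) = 0 for all x ∈ X; (5) A is simple. -/

import Mathlib

open MeasureTheory ProbabilityTheory

variable {X : Type*} [MeasurableSpace X]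

/-- Transition operator: `(Pf)(x) = ∫ f(y) P(x,dy)`. -/
noncomputable def transOp (P : Kernel X X) (f : X → ℝ) : X → ℝ :=
  fun x => ∫ y, f y ∂(P x)

/-- Invariance operator `I_A f = 1_A · (Pf)`. -/
noncomputable def invOp (P : Kernel X X) (A : Set X) (f : X → ℝ) : X → ℝ :=
  A.indicator (transOp P f)

/-- Invariance value functions `u_n(·;A)`. -/
noncomputable def uN (P : Kernel X X) (A : Set X) : ℕ → X → ℝ
  | 0 => A.indicator 1
  | n + 1 => invOp P A (uN P A n)

/-- `u(x;A) = lim_n u_n(x;A)` (the sequence is pointwise nonincreasing). -/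
noncomputable def uFun (P : Kernel X X) (A : Set X) : X → ℝ :=
  fun x => ⨅ n, uN P A n x

/-- Reach-avoid value functions `w_n(·;A,B)`. -/
noncomputable def wN (P : Kernel X X) (A B : Set X) : ℕ → X → ℝ
  | 0 => B.indicator 1
  | n + 1 => fun x => B.indicator 1 x + invOp P (A \ B) (wN P A B n) x

/-- `w(x;A,B) = lim_n w_n(x;A,B)` (the sequence is pointwise nondecreasing, in `[0,1]`). -/
noncomputable def wFun (P : Kernel X X) (A B : Set X) : X → ℝ :=
  fun x => ⨆ n, wN P A B n x

/-- A bounded function. -/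
def BddFun (f : X → ℝ) : Prop := ∃ C : ℝ, ∀ x, |f x| ≤ C

/-- A set `S` is absorbing if `P(x,S) = 1` for all `x ∈ S`. -/
def Absorbing (P : Kernel X X) (S : Set X) : Prop := ∀ x ∈ S, P x S = 1

/-- A set is simple if its only absorbing measurable subset is empty. -/
def Simple (P : Kernel X X) (A : Set X) : Prop :=
  ∀ S ⊆ A, MeasurableSet S → Absorbing P S → S = ∅


/-- The kernel `P` is weakly continuous (Feller) if `Pf` is bounded upper semicontinuous
whenever `f` is bounded upper semicontinuous. -/
def WeaklyCont {X : Type*} [MeasurableSpace X] [TopologicalSpace X] (P : Kernel X X) : Prop :=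
  ∀ f : X → ℝ, Measurable f → BddFun f → UpperSemicontinuous f →
    UpperSemicontinuous (transOp P f) ∧ BddFun (transOp P f)

section InvarianceValue

variable {P : Kernel X X} {A : Set X}

lemma uN_apply_of_notMem (n : ℕ) {x : X} (hx : x ∉ A) : uN P A n x = 0 := by
  cases n <;> simp [uN, invOp, hx]

lemma invOp_apply_of_mem (f : X → ℝ) {x : X} (hx : x ∈ A) : invOp P A f x = ∫ y, f y ∂(P x) := by
  simp [invOp, transOp, hx]

lemma uN_succ_apply_of_mem (n : ℕ) {x : X} (hx : x ∈ A) :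
    uN P A (n + 1) x = ∫ y, uN P A n y ∂(P x) :=
  invOp_apply_of_mem _ hx

lemma measurable_uN [IsMarkovKernel P] (hA : MeasurableSet A) (n : ℕ) :
    Measurable (uN P A n) := by
  induction n with
  | zero => exact measurable_one.indicator hA
  | succ n ih => exact (ih.stronglyMeasurable.integral_kernel (κ := P)).measurable.indicator hA

lemma uN_nonneg (n : ℕ) (x : X) : 0 ≤ uN P A n x := by
  induction n generalizing x with
  | zero => exact Set.indicator_nonneg (fun _ _ => zero_le_one) x
  | succ n ih => exact Set.indicator_nonneg (fun _ _ => integral_nonneg ih) x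

lemma integrable_of_measurable_of_mem_Icc {μ : Measure X} [IsFiniteMeasure μ] {f : X → ℝ}
    (hf : Measurable f) (h0 : ∀ x, 0 ≤ f x) (h1 : ∀ x, f x ≤ 1) : Integrable f μ :=
  .of_bound hf.aestronglyMeasurable 1
    (.of_forall fun x => by rw [Real.norm_of_nonneg (h0 x)]; exact h1 x)

lemma uN_le_one [IsMarkovKernel P] (hA : MeasurableSet A) (n : ℕ) (x : X) : uN P A n x ≤ 1 := by
  induction n generalizing x with
  | zero => exact Set.indicator_le_self' (fun _ _ => zero_le_one) x
  | succ n ih =>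
    by_cases hx : x ∈ A
    · rw [uN_succ_apply_of_mem n hx]
      calc ∫ y, uN P A n y ∂(P x) ≤ ∫ _, (1 : ℝ) ∂(P x) :=
            integral_mono (integrable_of_measurable_of_mem_Icc (measurable_uN hA n)
              (uN_nonneg n) ih) (integrable_const _) ih
        _ = 1 := by simp
    · simp [uN_apply_of_notMem (n + 1) hx]

lemma integrable_uN [IsMarkovKernel P] (hA : MeasurableSet A) (n : ℕ) (x : X) :
    Integrable (uN P A n) (P x) :=
  integrable_of_measurable_of_mem_Icc (measurable_uN hA n) (uN_nonneg n) (uN_le_one hA n)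

lemma bddFun_uN [IsMarkovKernel P] (hA : MeasurableSet A) (n : ℕ) : BddFun (uN P A n) :=
  ⟨1, fun x => by rw [abs_of_nonneg (uN_nonneg n x)]; exact uN_le_one hA n x⟩

lemma uN_succ_le [IsMarkovKernel P] (hA : MeasurableSet A) (n : ℕ) (x : X) :
    uN P A (n + 1) x ≤ uN P A n x := by
  by_cases hx : x ∈ A
  · induction n generalizing x with
    | zero => simpa [uN, hx] using uN_le_one (P := P) hA 1 x
    | succ n ih =>
      rw [uN_succ_apply_of_mem _ hx, uN_succ_apply_of_mem _ hx]
      refine integral_mono (integrable_uN hA _ x) (integrable_uN hA _ x) fun y => ?_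
      by_cases hy : y ∈ A
      · exact ih y hy
      · simp [uN_apply_of_notMem _ hy]
  · simp [uN_apply_of_notMem _ hx]

lemma antitone_uN [IsMarkovKernel P] (hA : MeasurableSet A) (x : X) :
    Antitone fun n => uN P A n x :=
  antitone_nat_of_succ_le fun n => uN_succ_le hA n x

lemma bddBelow_range_uN (x : X) : BddBelow (Set.range fun n => uN P A n x) :=
  ⟨0, by rintro _ ⟨n, rfl⟩; exact uN_nonneg n x⟩

lemma uFun_le_uN (n : ℕ) (x : X) : uFun P A x ≤ uN P A n x :=
  ciInf_le (bddBelow_range_uN x) n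

lemma uFun_nonneg (x : X) : 0 ≤ uFun P A x := le_ciInf fun n => uN_nonneg n x

lemma uFun_le_one [IsMarkovKernel P] (hA : MeasurableSet A) (x : X) : uFun P A x ≤ 1 :=
  (uFun_le_uN 0 x).trans (uN_le_one hA 0 x)

lemma uFun_apply_of_notMem {x : X} (hx : x ∉ A) : uFun P A x = 0 :=
  le_antisymm ((uFun_le_uN 0 x).trans_eq (uN_apply_of_notMem 0 hx)) (uFun_nonneg x)

lemma measurable_uFun [IsMarkovKernel P] (hA : MeasurableSet A) : Measurable (uFun P A) :=
  .iInf fun n => measurable_uN hA n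

lemma tendsto_uN_uFun [IsMarkovKernel P] (hA : MeasurableSet A) (x : X) :
    Filter.Tendsto (fun n => uN P A n x) Filter.atTop (nhds (uFun P A x)) :=
  tendsto_atTop_ciInf (antitone_uN hA x) (bddBelow_range_uN x)

lemma uFun_eq_invOp [IsMarkovKernel P] (hA : MeasurableSet A) (x : X) :
    uFun P A x = invOp P A (uFun P A) x := by
  by_cases hx : x ∈ A
  · rw [invOp_apply_of_mem _ hx]
    refine tendsto_nhds_unique ((tendsto_uN_uFun hA x).comp (Filter.tendsto_add_atTop_nat 1)) ?_
    refine (tendsto_integral_of_dominated_convergence (fun _ => (1 : ℝ))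
      (fun n => (measurable_uN hA n).aestronglyMeasurable) (integrable_const _)
      (fun n => .of_forall fun y => ?_) (.of_forall fun y => tendsto_uN_uFun hA y)).congr
      fun n => (uN_succ_apply_of_mem n hx).symm
    rw [Real.norm_of_nonneg (uN_nonneg n y)]
    exact uN_le_one hA n y
  · simp [uFun_apply_of_notMem hx, invOp, hx]

lemma uFun_eq_one_iff [IsMarkovKernel P] (hA : MeasurableSet A) (x : X) :
    uFun P A x = 1 ↔ ∀ n, 1 ≤ uN P A n x :=
  ⟨fun h n => h ▸ uFun_le_uN n x, fun h => le_antisymm (uFun_le_one hA x) (le_ciInf h)⟩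

lemma mem_of_uFun_eq_one {x : X} (hx : uFun P A x = 1) : x ∈ A := by
  by_contra h
  simp [uFun_apply_of_notMem h] at hx

lemma measurableSet_uFun_eq_one [IsMarkovKernel P] (hA : MeasurableSet A) :
    MeasurableSet {x | uFun P A x = 1} :=
  measurable_uFun hA (measurableSet_singleton 1)

lemma absorbing_uFun_eq_one [IsMarkovKernel P] (hA : MeasurableSet A) :
    Absorbing P {x | uFun P A x = 1} := by
  intro x hx
  have hint : Integrable (uFun P A) (P x) :=
    integrable_of_measurable_of_mem_Icc (measurable_uFun hA) uFun_nonneg (uFun_le_one hA)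
  have h1 : ∫ y, uFun P A y ∂(P x) = 1 := by
    rw [← invOp_apply_of_mem _ (mem_of_uFun_eq_one hx), ← uFun_eq_invOp hA x, hx]
  have h0 : ∫ y, (1 - uFun P A y) ∂(P x) = 0 := by
    rw [integral_sub (integrable_const _) hint, h1]
    simp
  have hae := (integral_eq_zero_iff_of_nonneg (fun y => sub_nonneg.2 (uFun_le_one hA y))
    ((integrable_const _).sub hint)).1 h0
  refine (prob_compl_eq_zero_iff (measurableSet_uFun_eq_one hA)).1 (mem_ae_iff.1 ?_)
  filter_upwards [hae] with y hy
  exact (sub_eq_zero.1 hy).symm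

lemma Absorbing.uN_eq_one [IsMarkovKernel P] {S : Set X} (hS : Absorbing P S) (hSA : S ⊆ A)
    (hSm : MeasurableSet S) (n : ℕ) {x : X} (hx : x ∈ S) : uN P A n x = 1 := by
  induction n generalizing x with
  | zero => simp [uN, hSA hx]
  | succ n ih =>
    have hae : uN P A n =ᵐ[P x] fun _ => (1 : ℝ) := by
      filter_upwards [mem_ae_iff.2 ((prob_compl_eq_zero_iff hSm).2 (hS x hx))] with y hy
      exact ih hy
    rw [uN_succ_apply_of_mem n (hSA hx), integral_congr_ae hae]
    simp

lemma abs_iterate_invOp_le [IsMarkovKernel P] (hA : MeasurableSet A) {f : X → ℝ} {M : ℝ}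
    (hM : ∀ x, |f x| ≤ M) (n : ℕ) (x : X) :
    |(invOp P A)^[n + 1] f x| ≤ M * uN P A n x := by
  simp only [← Real.norm_eq_abs] at hM ⊢
  rw [Function.iterate_succ_apply']
  by_cases hx : x ∈ A
  · rw [invOp_apply_of_mem _ hx]
    induction n generalizing x with
    | zero =>
      simpa [uN, hx] using norm_integral_le_of_norm_le_const (μ := P x) (.of_forall hM)
    | succ n ih =>
      rw [uN_succ_apply_of_mem n hx, ← integral_const_mul]
      refine norm_integral_le_of_norm_le ((integrable_uN hA n x).const_mul M)
        (.of_forall fun y => ?_)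
      rw [Function.iterate_succ_apply']
      by_cases hy : y ∈ A
      · rw [invOp_apply_of_mem _ hy]
        exact ih y hy
      · simp [invOp, hy, uN_apply_of_notMem n hy]
  · simp [invOp, hx, uN_apply_of_notMem n hx]

omit [MeasurableSpace X] in
lemma BddFun.abs_le_iSup {f : X → ℝ} (hf : BddFun f) (x : X) : |f x| ≤ ⨆ y, |f y| := by
  obtain ⟨C, hC⟩ := hf
  exact le_ciSup (f := fun y => |f y|) ⟨C, by rintro _ ⟨y, rfl⟩; exact hC y⟩ x

lemma eq_zero_of_iterate_invOp_contraction {n : ℕ} {c : ℝ} (hc : c < 1) {f : X → ℝ}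
    (hf : BddFun f) (hcontr : ∀ x, |(invOp P A)^[n] f x| ≤ c * ⨆ y, |f y|)
    (hfix : ∀ x, f x = invOp P A f x) (x : X) : f x = 0 := by
  rw [Function.iterate_fixed (funext fun x => (hfix x).symm) n] at hcontr
  have : Nonempty X := ⟨x⟩
  have hle : ⨆ y, |f y| ≤ c * ⨆ y, |f y| := ciSup_le hcontr
  have hx := hf.abs_le_iSup x
  exact abs_eq_zero.1 (le_antisymm (by nlinarith [abs_nonneg (f x)]) (abs_nonneg _))

end InvarianceValue

section Feller

variable [TopologicalSpace X] {P : Kernel X X} {A : Set X}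

omit [MeasurableSpace X] in
lemma UpperSemicontinuous.indicator_of_isClosed {f : X → ℝ} (hf : UpperSemicontinuous f)
    (h0 : ∀ x, 0 ≤ f x) (hA : IsClosed A) : UpperSemicontinuous (A.indicator f) := by
  intro x c hc
  by_cases hx : x ∈ A
  · rw [Set.indicator_of_mem hx] at hc
    filter_upwards [hf x c hc] with y hy
    exact (Set.indicator_le_self' (fun _ _ => h0 _) y).trans_lt hy
  · rw [Set.indicator_of_notMem hx] at hc
    filter_upwards [hA.isOpen_compl.mem_nhds hx] with y hy
    rwa [Set.indicator_of_notMem hy]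

lemma upperSemicontinuous_uN [IsMarkovKernel P] (hP : WeaklyCont P) (hA : MeasurableSet A)
    (hAc : IsClosed A) (n : ℕ) : UpperSemicontinuous (uN P A n) := by
  induction n with
  | zero => exact upperSemicontinuous_const.indicator_of_isClosed (fun _ => zero_le_one) hAc
  | succ n ih =>
    exact (hP _ (measurable_uN hA n) (bddFun_uN hA n) ih).1.indicator_of_isClosed
      (fun x => integral_nonneg (uN_nonneg n)) hAc

lemma isClosed_one_le_uN [IsMarkovKernel P] (hP : WeaklyCont P) (hA : MeasurableSet A)
    (hAc : IsClosed A) (n : ℕ) : IsClosed {x | 1 ≤ uN P A n x} :=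
  (upperSemicontinuous_uN hP hA hAc n).isClosed_preimage 1

lemma isCompact_uFun_eq_one [IsMarkovKernel P] (hP : WeaklyCont P) (hA : MeasurableSet A)
    (hAc : IsClosed A) (hAcp : IsCompact A) : IsCompact {x | uFun P A x = 1} := by
  refine hAcp.of_isClosed_subset ?_ fun x hx => mem_of_uFun_eq_one hx
  simp only [uFun_eq_one_iff hA, Set.ofPred_forall]
  exact isClosed_iInter (isClosed_one_le_uN hP hA hAc)

lemma nonempty_one_le_uN [IsMarkovKernel P] (hP : WeaklyCont P) (hA : MeasurableSet A)
    (hAc : IsClosed A) (hAcp : IsCompact A) {n : ℕ} (hn : 1 ≤ ⨆ x, uN P A n x) :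
    {x | 1 ≤ uN P A n x}.Nonempty := by
  have hne : A.Nonempty := by
    by_contra h
    rw [Set.not_nonempty_iff_eq_empty] at h
    have : ∀ x, uN P A n x = 0 := fun x => uN_apply_of_notMem n (by simp [h])
    norm_num [this] at hn
  obtain ⟨a, -, ha⟩ := ((upperSemicontinuous_uN hP hA hAc n).upperSemicontinuousOn A).exists_isMaxOn
    hne hAcp
  have : Nonempty X := ⟨a⟩
  refine ⟨a, hn.trans (ciSup_le fun x => ?_)⟩
  by_cases hx : x ∈ A
  · exact ha hx
  · exact (uN_apply_of_notMem n hx).trans_le (uN_nonneg n a)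

lemma nonempty_uFun_eq_one [IsMarkovKernel P] (hP : WeaklyCont P) (hA : MeasurableSet A)
    (hAc : IsClosed A) (hAcp : IsCompact A) (h : ∀ n, 1 ≤ ⨆ x, uN P A n x) :
    {x | uFun P A x = 1}.Nonempty := by
  simp only [uFun_eq_one_iff hA, Set.ofPred_forall]
  refine IsCompact.nonempty_iInter_of_sequence_nonempty_isCompact_isClosed _
    (fun n x hx => le_trans hx (uN_succ_le hA n x))
    (fun n => nonempty_one_le_uN hP hA hAc hAcp (h n)) ?_ (isClosed_one_le_uN hP hA hAc)
  refine hAcp.of_isClosed_subset (isClosed_one_le_uN hP hA hAc 0) fun x hx => ?_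
  by_contra hxA
  norm_num [uN_apply_of_notMem 0 hxA] at hx

end Feller

/-- for a weakly continuous Markov kernel on a Borel subset `X₀` of a Polish
space and a compact measurable set `A`, the largest absorbing subset `{x : u(x;A) = 1}` is
compact, and the following are equivalent: (1) `m(A) < ∞`; (2) some iterate `I_A^n` (`n ≥ 1`)
is a contraction with constant `c < 1`; (3) the only bounded measurable solution of `f = I_A f`
is `f ≡ 0`; (4) `u(·;A) ≡ 0`; (5) `A` is simple. -/
theorem stmt10 {Y : Type*} [TopologicalSpace Y] [PolishSpace Y]
    [MeasurableSpace Y] [BorelSpace Y] {X₀ : Set Y} (hX₀ : MeasurableSet X₀)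
    (P : Kernel ↥X₀ ↥X₀) [IsMarkovKernel P] (hP : WeaklyCont P)
    (A : Set ↥X₀) (hA : MeasurableSet A) (hAcp : IsCompact A) :
    IsCompact {x | uFun P A x = 1} ∧
      [ {k : ℕ | (⨆ x, uN P A k x) < 1}.Nonempty,
        (∃ n : ℕ, 1 ≤ n ∧ ∃ c : ℝ, c < 1 ∧
          ∀ f : ↥X₀ → ℝ, Measurable f → BddFun f →
            ∀ x, |(invOp P A)^[n] f x| ≤ c * ⨆ y, |f y|),
        (∀ f : ↥X₀ → ℝ, Measurable f → BddFun f →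
          (∀ x, f x = invOp P A f x) → ∀ x, f x = 0),
        (∀ x, uFun P A x = 0),
        Simple P A ].TFAE := by
  have hAc : IsClosed A := hAcp.isClosed
  refine ⟨isCompact_uFun_eq_one hP hA hAc hAcp, ?_⟩
  tfae_have 1 → 2 := by
    rintro ⟨k, hk⟩
    refine ⟨k + 1, Nat.le_add_left 1 k, _, hk, fun f _ hfb x => ?_⟩
    refine (abs_iterate_invOp_le hA hfb.abs_le_iSup k x).trans ?_
    rw [mul_comm]
    refine mul_le_mul_of_nonneg_right
      (le_ciSup (f := uN P A k) ⟨1, by rintro _ ⟨y, rfl⟩; exact uN_le_one hA k y⟩ x) ?_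
    exact (abs_nonneg _).trans (hfb.abs_le_iSup x)
  tfae_have 2 → 3 := by
    rintro ⟨n, -, c, hc, h⟩ f hf hfb hfix
    exact eq_zero_of_iterate_invOp_contraction hc hfb (h f hf hfb) hfix
  tfae_have 3 → 4 := fun h =>
    h _ (measurable_uFun hA)
      ⟨1, fun x => by rw [abs_of_nonneg (uFun_nonneg x)]; exact uFun_le_one hA x⟩
      (uFun_eq_invOp hA)
  tfae_have 4 → 5 := by
    intro h S hSA hSm hS
    refine Set.eq_empty_of_forall_notMem fun x hx => zero_ne_one (α := ℝ) ?_
    rw [← h x, uFun_eq_one_iff hA]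
    exact fun n => (hS.uN_eq_one hSA hSm n hx).ge
  tfae_have 5 → 1 := by
    intro h
    by_contra hne
    refine (nonempty_uFun_eq_one hP hA hAc hAcp fun n => not_lt.1 fun hn => hne ⟨n, hn⟩).ne_empty ?_
    exact h _ (fun x hx => mem_of_uFun_eq_one hx) (measurableSet_uFun_eq_one hA)
      (absorbing_uFun_eq_one hA)
  tfae_finish
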